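/- Let X be a complex Hilbert space and T ∈ B(X) a power-bounded operator such that σ(T) ∩ 𝕋 = {1} and ‖R(e^{iθ},T)‖ = O(|θ|⁻¹) as θ → 0. Then ‖Tⁿ(I−T)‖ = O(n⁻¹) as n → ∞. -/

import Mathlib

open Finset in
/-- Finite Parseval identity for vector-valued trigonometric sums. -/
lemma aux_parseval {X : Type*} [NormedAddCommGroup X] [InnerProductSpace ℂ X]
    (L : ℕ) (ω : ℂ) (hω : IsPrimitiveRoot ω L) (h1 : ‖ω‖ = 1) (a : ℕ → X) :
    ∑ j ∈ range L, ‖∑ n ∈ range L, (ω ^ j) ^ n • a n‖ ^ 2 = L * ∑ n ∈ range L, ‖a n‖ ^ 2 := by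
  have hcc : (starRingEnd ℂ) ω * ω = 1 := by
    rw [mul_comm, Complex.mul_conj, Complex.normSq_eq_norm_sq, h1]; simp
  have key : ∀ m ∈ range L, ∀ n ∈ range L,
      ∑ j ∈ range L, (starRingEnd ℂ) ((ω ^ j) ^ m) * (ω ^ j) ^ n = if m = n then (L : ℂ) else 0 := by
    intro m hm n hn
    have e : ∀ j, (starRingEnd ℂ) ((ω ^ j) ^ m) * (ω ^ j) ^ n
        = ((starRingEnd ℂ) ω ^ m * ω ^ n) ^ j := by
      intro j
      simp only [map_pow]
      rw [mul_pow]
      simp only [← pow_mul]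
      rw [mul_comm j m, mul_comm j n]
    simp only [e]
    split_ifs with h
    · subst h
      rw [← mul_pow, hcc]; simp
    · have hne : (starRingEnd ℂ) ω ^ m * ω ^ n ≠ 1 := by
        intro h'
        apply h
        apply hω.pow_inj (mem_range.1 hm) (mem_range.1 hn)
        calc ω ^ m = ω ^ m * ((starRingEnd ℂ) ω ^ m * ω ^ n) := by rw [h', mul_one]
          _ = ((starRingEnd ℂ) ω * ω) ^ m * ω ^ n := by rw [mul_pow]; ring
          _ = ω ^ n := by rw [hcc]; simp
      rw [geom_sum_eq hne]
      have : ((starRingEnd ℂ) ω ^ m * ω ^ n) ^ L = 1 := by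
        rw [mul_pow, ← pow_mul, ← pow_mul, mul_comm m, mul_comm n, pow_mul, pow_mul, ← map_pow,
          hω.pow_eq_one]
        simp
      rw [this]; simp
  have h2 : ∀ x : X, ((‖x‖ ^ 2 : ℝ) : ℂ) = inner ℂ x x := by
    intro x
    rw [inner_self_eq_norm_sq_to_K]; simp
  apply Complex.ofReal_injective
  rw [Complex.ofReal_mul, Complex.ofReal_sum, Complex.ofReal_sum]
  simp only [h2, sum_inner, inner_sum, inner_smul_left, inner_smul_right]
  rw [sum_comm, Complex.ofReal_natCast, mul_sum]
  apply sum_congr rfl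
  intro m hm
  simp only [mul_sum]
  rw [sum_comm]
  have : ∀ n ∈ range L, ∑ j ∈ range L, (ω ^ j) ^ m * ((starRingEnd ℂ) ((ω ^ j) ^ n) * inner ℂ (a n) (a m))
      = (if n = m then (L : ℂ) else 0) * inner ℂ (a n) (a m) := by
    intro n hn
    rw [← key n hn m hm, sum_mul]
    exact sum_congr rfl fun j _ => by ring
  rw [sum_congr rfl this]
  simp only [ite_mul, zero_mul, sum_ite_eq', hm, if_true]

/-- Uniform bound for `(1 - T) R(z, T)` on the unit circle minus the point `1`. -/
lemma aux_bound {X : Type*} [NormedAddCommGroup X] [InnerProductSpace ℂ X] [CompleteSpace X]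
    (T : X →L[ℂ] X)
    (hsp : spectrum ℂ T ∩ {z : ℂ | ‖z‖ = 1} = {1})
    (hO : ∃ C > (0 : ℝ), ∃ δ > (0 : ℝ), ∀ θ : ℝ, 0 < |θ| → |θ| < δ →
      ‖resolvent T (Complex.exp (θ * Complex.I))‖ ≤ C / |θ|) :
    ∃ K : ℝ, 1 ≤ K ∧ ∀ z : ℂ, ‖z‖ = 1 → z ≠ 1 →
      z ∈ resolventSet ℂ T ∧ ‖(1 - T) * resolvent T z‖ ≤ K := by
  obtain ⟨C, hC, δ, hδ, hO⟩ := hO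
  have hres : ∀ z : ℂ, ‖z‖ = 1 → z ≠ 1 → z ∈ resolventSet ℂ T := by
    intro z hz hz1
    by_contra h
    have : z ∈ spectrum ℂ T ∩ {z : ℂ | ‖z‖ = 1} := ⟨h, hz⟩
    rw [hsp] at this
    exact hz1 this
  have hne : ∀ θ : ℝ, 0 < |θ| → |θ| ≤ Real.pi → Complex.exp (θ * Complex.I) ≠ 1 := by
    intro θ h0 hpi h
    rw [Complex.exp_eq_one_iff] at h
    obtain ⟨n, hn⟩ := h
    have hn' : (θ : ℂ) = ((n * (2 * Real.pi) : ℝ) : ℂ) := by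
      have := mul_right_cancel₀ Complex.I_ne_zero (hn.trans (mul_assoc _ _ _).symm)
      rw [this]; push_cast; ring
    have hn2 := Complex.ofReal_injective hn'
    rw [hn2, abs_mul, abs_of_pos Real.two_pi_pos] at hpi h0
    have hpp := Real.pi_pos
    have : n ≠ 0 := by rintro rfl; simp at h0
    have h1 : (1 : ℝ) ≤ |(n : ℝ)| := by exact_mod_cast Int.one_le_abs this
    nlinarith
  have hcpt : IsCompact {θ : ℝ | δ ≤ |θ| ∧ |θ| ≤ Real.pi} := by
    apply IsCompact.of_isClosed_subset (isCompact_Icc (a := -Real.pi) (b := Real.pi))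
    · exact (isClosed_le continuous_const continuous_abs).inter
        (isClosed_le continuous_abs continuous_const)
    · rintro θ ⟨_, h⟩
      exact abs_le.1 h
  have hcont : ContinuousOn (fun θ : ℝ => resolvent T (Complex.exp (θ * Complex.I)))
      {θ : ℝ | δ ≤ |θ| ∧ |θ| ≤ Real.pi} := by
    rintro θ ⟨h1, h2⟩
    apply ContinuousAt.continuousWithinAt
    have hr := hres (Complex.exp (θ * Complex.I)) (Complex.norm_exp_ofReal_mul_I θ)
      (hne θ (hδ.trans_le h1) h2)
    have hc := (spectrum.hasDerivAt_resolvent hr).continuousAt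
    have he : ContinuousAt (fun θ : ℝ => Complex.exp (θ * Complex.I)) θ := by fun_prop
    exact ContinuousAt.comp (f := fun θ : ℝ => Complex.exp (θ * Complex.I)) hc he
  obtain ⟨B, hB⟩ := hcpt.exists_bound_of_continuousOn hcont
  refine ⟨1 + C + 2 * |B|, by linarith [abs_nonneg B], fun z hz hz1 => ⟨hres z hz hz1, ?_⟩⟩
  have hunit : (algebraMap ℂ (X →L[ℂ] X) z - T) * resolvent T z = 1 :=
    Ring.mul_inverse_cancel _ (hres z hz hz1)
  have hid : (1 - T) * resolvent T z = 1 + (1 - z) • resolvent T z := by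
    have : (1 - T) = (algebraMap ℂ (X →L[ℂ] X) z - T) + (1 - z) • 1 := by
      rw [Algebra.algebraMap_eq_smul_one, sub_smul, one_smul]; abel
    rw [this, add_mul, hunit, smul_mul_assoc, one_mul]
  have hone : ‖(1 : X →L[ℂ] X)‖ ≤ 1 := ContinuousLinearMap.norm_id_le
  have hz' : Complex.exp (z.arg * Complex.I) = z := by
    have := Complex.norm_mul_exp_arg_mul_I z
    rwa [hz, Complex.ofReal_one, one_mul] at this
  have harg : 0 < |z.arg| := by
    rw [abs_pos]
    intro h
    rw [h] at hz'
    apply hz1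
    rw [← hz']; simp
  have h1 : ‖(1 - z) • resolvent T z‖ ≤ C + 2 * |B| := by
    rw [norm_smul]
    by_cases hlt : |z.arg| < δ
    · have h := hO z.arg harg hlt
      rw [hz'] at h
      have h3 : ‖1 - z‖ ≤ |z.arg| := by
        have := Real.norm_exp_I_mul_ofReal_sub_one_le (x := z.arg)
        rw [mul_comm, hz', norm_sub_rev] at this
        simpa using this
      calc ‖1 - z‖ * ‖resolvent T z‖ ≤ |z.arg| * (C / |z.arg|) := by gcongr
        _ = C := by field_simp
        _ ≤ _ := by linarith [abs_nonneg B]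
    · have h := hB z.arg ⟨not_lt.1 hlt, Complex.abs_arg_le_pi z⟩
      rw [hz'] at h
      have h3 : ‖1 - z‖ ≤ 2 := by
        refine (norm_sub_le _ _).trans ?_
        rw [hz, norm_one]; norm_num
      calc ‖1 - z‖ * ‖resolvent T z‖ ≤ 2 * |B| := by
            gcongr
            exact h.trans (le_abs_self B)
        _ ≤ _ := by linarith
  rw [hid]
  refine (norm_add_le _ _).trans ?_
  linarith

open Finset in
/-- Summation identity. -/
lemma aux_tele {A : Type*} [Ring A] (S : A) (c : ℕ → A) (hc : ∀ n, Commute (c n) S) (L : ℕ)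
    (h0 : c 0 = 0) :
    (1 - S) * ∑ n ∈ range L, c n * S ^ n
      = ∑ n ∈ range L, (c (n + 1) - c n) * S ^ (n + 1) - c L * S ^ L := by
  induction L with
  | zero => simp [h0]
  | succ L ih =>
    rw [sum_range_succ, mul_add, ih, sum_range_succ, sub_mul, sub_mul, one_mul,
      ← mul_assoc S, ← (hc L).eq, mul_assoc (c L), ← pow_succ']
    abel

theorem stmt_18 {X : Type*} [NormedAddCommGroup X] [InnerProductSpace ℂ X] [CompleteSpace X]
    (T : X →L[ℂ] X) (M : ℝ) (hM : ∀ m : ℕ, ‖T ^ m‖ ≤ M)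
    (hsp : spectrum ℂ T ∩ {z : ℂ | ‖z‖ = 1} = {1})
    (hO : ∃ C > (0 : ℝ), ∃ δ > (0 : ℝ), ∀ θ : ℝ, 0 < |θ| → |θ| < δ →
      ‖resolvent T (Complex.exp (θ * Complex.I))‖ ≤ C / |θ|) :
    ∃ C > (0 : ℝ), ∀ n : ℕ, 1 ≤ n → ‖T ^ n * (1 - T)‖ ≤ C / n := by
  obtain ⟨K, hK1, hK⟩ := aux_bound T hsp hO
  have hM0 : 0 ≤ M := (norm_nonneg _).trans (hM 0)
  refine ⟨3 * K * M ^ 2 + 1, by positivity, ?_⟩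
  intro m hm
  have hmR : (0 : ℝ) < m := by exact_mod_cast hm
  -- the main estimate
  have main : ∀ x : X, ‖(T ^ m * (1 - T)) x‖ ≤ 3 * K * M ^ 2 / m * ‖x‖ := by
    intro x
    set L := 2 * m with hL
    have hL0 : L ≠ 0 := by omega
    set ω := Complex.exp (2 * Real.pi * Complex.I / L) with hωdef
    have hω : IsPrimitiveRoot ω L := Complex.isPrimitiveRoot_exp L hL0
    have hω1 : ‖ω‖ = 1 := hω.norm'_eq_one hL0
    -- tent function
    let c : ℕ → ℝ := fun n => min (n : ℝ) (L - n)
    have hc0 : c 0 = 0 := by simp [c]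
    have hcL : c L = 0 := by simp [c]
    have hd : ∀ n, |c (n + 1) - c n| ≤ 1 := by
      intro n
      simp only [c]; push_cast
      rw [abs_le]
      constructor <;>
      rcases min_cases ((n : ℝ) + 1) (L - (n + 1)) with ⟨h, h'⟩ | ⟨h, h'⟩ <;>
      rcases min_cases (n : ℝ) (L - n) with ⟨g, g'⟩ | ⟨g, g'⟩ <;> rw [h, g] <;> linarith
    have hcm : ∀ n, n ≤ m → c n = n := by
      intro n hn
      apply min_eq_left
      have : (n : ℝ) ≤ m := by exact_mod_cast hn
      rw [hL]; push_cast; linarith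
    let w : ℕ → X := fun n => (c n : ℂ) • (T ^ n * (1 - T)) x
    let v : ℕ → X := fun n => ((c (n + 1) - c n : ℝ) : ℂ) • (T ^ (n + 1)) x
    -- pointwise comparison
    have hpt : ∀ μ : ℂ, ‖μ‖ = 1 →
        ‖∑ n ∈ Finset.range L, μ ^ n • w n‖ ≤ K * ‖∑ n ∈ Finset.range L, μ ^ n • v n‖ := by
      intro μ hμ
      have hμ0 : μ ≠ 0 := by rintro rfl; simp at hμ
      let P : X →L[ℂ] X := ∑ n ∈ Finset.range L, ((c n : ℂ) * μ ^ n) • T ^ n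
      let Q : X →L[ℂ] X :=
        ∑ n ∈ Finset.range L, (((c (n + 1) - c n : ℝ) : ℂ) * μ ^ n) • T ^ (n + 1)
      have hPQ : (1 - μ • T) * P = μ • Q := by
        have := aux_tele (μ • T) (fun n => algebraMap ℂ (X →L[ℂ] X) (c n))
          (fun n => Algebra.commutes _ _) L (by simp [hc0])
        simp only [hcL, Complex.ofReal_zero, map_zero, zero_mul, sub_zero, ← map_sub,
          ← Algebra.smul_def, smul_pow, smul_smul] at this
        simp only [P, Q, Finset.smul_sum, smul_smul]
        rw [this]
        refine Finset.sum_congr rfl fun n _ => ?_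
        push_cast
        congr 1
        ring
      have hPT : Commute P T := by
        apply Commute.sum_left
        intro n _
        exact ((Commute.refl T).pow_left n).smul_left _
      have hw : ∑ n ∈ Finset.range L, μ ^ n • w n = ((1 - T) * P) x := by
        rw [← ((Commute.one_right P).sub_right hPT).eq]
        simp only [P, w, Finset.sum_mul, ContinuousLinearMap.sum_apply]
        refine Finset.sum_congr rfl fun n _ => ?_
        rw [smul_mul_assoc, ContinuousLinearMap.smul_apply, smul_smul, mul_comm]
      have hv : ∑ n ∈ Finset.range L, μ ^ n • v n = Q x := by
        simp only [Q, v, ContinuousLinearMap.sum_apply]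
        refine Finset.sum_congr rfl fun n _ => ?_
        rw [ContinuousLinearMap.smul_apply, smul_smul, mul_comm]
      rw [hw, hv]
      by_cases hμ1 : μ = 1
      · rw [hμ1, one_smul, one_smul] at hPQ
        rw [hPQ]
        exact le_mul_of_one_le_left (norm_nonneg _) hK1
      · obtain ⟨hr, hb⟩ := hK μ⁻¹ (by rw [norm_inv, hμ, inv_one]) (by simpa using hμ1)
        have hinv : resolvent T μ⁻¹ * (algebraMap ℂ (X →L[ℂ] X) μ⁻¹ - T) = 1 :=
          Ring.inverse_mul_cancel _ hr
        have h3 : (algebraMap ℂ (X →L[ℂ] X) μ⁻¹ - T) * P = Q := by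
          have : (algebraMap ℂ (X →L[ℂ] X) μ⁻¹ - T) = μ⁻¹ • (1 - μ • T) := by
            rw [smul_sub, smul_smul, inv_mul_cancel₀ hμ0, one_smul,
              Algebra.algebraMap_eq_smul_one]
          rw [this, smul_mul_assoc, hPQ, smul_smul, inv_mul_cancel₀ hμ0, one_smul]
        have h4 : (1 - T) * P = ((1 - T) * resolvent T μ⁻¹) * Q := by
          rw [← h3, mul_assoc, ← mul_assoc (resolvent T μ⁻¹), hinv, one_mul]
        rw [h4]
        exact ((((1 - T) * resolvent T μ⁻¹)).le_opNorm (Q x)).trans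
          (mul_le_mul_of_nonneg_right hb (norm_nonneg _))
    -- Parseval
    have hpars : ∑ n ∈ Finset.range L, ‖w n‖ ^ 2 ≤ K ^ 2 * ∑ n ∈ Finset.range L, ‖v n‖ ^ 2 := by
      have hLR : (0 : ℝ) < L := by exact_mod_cast Nat.pos_of_ne_zero hL0
      have e1 := aux_parseval L ω hω hω1 w
      have e2 := aux_parseval L ω hω hω1 v
      have : ∑ j ∈ Finset.range L, ‖∑ n ∈ Finset.range L, (ω ^ j) ^ n • w n‖ ^ 2
          ≤ K ^ 2 * ∑ j ∈ Finset.range L, ‖∑ n ∈ Finset.range L, (ω ^ j) ^ n • v n‖ ^ 2 := by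
        rw [Finset.mul_sum]
        refine Finset.sum_le_sum fun j _ => ?_
        rw [← mul_pow]
        exact pow_le_pow_left₀ (norm_nonneg _)
          (hpt (ω ^ j) (by rw [norm_pow, hω1, one_pow])) 2
      rw [e1, e2] at this
      refine le_of_mul_le_mul_left (this.trans_eq ?_) hLR
      ring
    have hvb : ∑ n ∈ Finset.range L, ‖v n‖ ^ 2 ≤ L * (M * ‖x‖) ^ 2 := by
      have : ∀ n ∈ Finset.range L, ‖v n‖ ^ 2 ≤ (M * ‖x‖) ^ 2 := by
        intro n _
        refine pow_le_pow_left₀ (norm_nonneg _) ?_ 2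
        simp only [v]
        rw [norm_smul, Complex.norm_real, Real.norm_eq_abs]
        calc _ ≤ 1 * (M * ‖x‖) := by
              gcongr
              · exact hd n
              · exact ((T ^ (n + 1)).le_opNorm x).trans
                  (mul_le_mul_of_nonneg_right (hM _) (norm_nonneg _))
          _ = _ := one_mul _
      refine (Finset.sum_le_sum this).trans_eq ?_
      simp
    set y := ‖(T ^ m * (1 - T)) x‖ with hy
    have hlow : ∀ n ∈ Finset.range (m + 1), ((n : ℝ) * y) ^ 2 ≤ M ^ 2 * ‖w n‖ ^ 2 := by
      intro n hn
      have hn' : n ≤ m := Nat.lt_succ_iff.1 (Finset.mem_range.1 hn)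
      rw [← mul_pow]
      refine pow_le_pow_left₀ (by positivity) ?_ 2
      simp only [w]
      rw [norm_smul, Complex.norm_real, Real.norm_eq_abs, hcm n hn', Nat.abs_cast]
      have : y ≤ M * ‖(T ^ n * (1 - T)) x‖ := by
        rw [hy, ← Nat.sub_add_cancel hn', pow_add, mul_assoc, ContinuousLinearMap.mul_apply]
        exact ((T ^ (m - n)).le_opNorm _).trans
          (mul_le_mul_of_nonneg_right (hM _) (norm_nonneg _))
      calc (n : ℝ) * y ≤ n * (M * ‖(T ^ n * (1 - T)) x‖) := by gcongr
        _ = _ := by ring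
    have hsq : ∀ k : ℕ, (k : ℝ) ^ 3 / 3 ≤ ∑ n ∈ Finset.range (k + 1), (n : ℝ) ^ 2 := by
      intro k
      induction k with
      | zero => simp
      | succ k ih =>
        rw [Finset.sum_range_succ]
        push_cast
        nlinarith [(Nat.cast_nonneg k : (0 : ℝ) ≤ k)]
    have hfin : (m : ℝ) ^ 3 / 3 * y ^ 2 ≤ M ^ 2 * (K ^ 2 * (L * (M * ‖x‖) ^ 2)) := by
      calc (m : ℝ) ^ 3 / 3 * y ^ 2 ≤ (∑ n ∈ Finset.range (m + 1), (n : ℝ) ^ 2) * y ^ 2 := by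
            gcongr
            exact hsq m
        _ = ∑ n ∈ Finset.range (m + 1), ((n : ℝ) * y) ^ 2 := by
            rw [Finset.sum_mul]
            exact Finset.sum_congr rfl fun n _ => by ring
        _ ≤ ∑ n ∈ Finset.range (m + 1), M ^ 2 * ‖w n‖ ^ 2 := Finset.sum_le_sum hlow
        _ ≤ ∑ n ∈ Finset.range L, M ^ 2 * ‖w n‖ ^ 2 := by
            apply Finset.sum_le_sum_of_subset_of_nonneg
            · apply Finset.range_subset_range.2; omega
            · intros; positivity
        _ = M ^ 2 * ∑ n ∈ Finset.range L, ‖w n‖ ^ 2 := by rw [Finset.mul_sum]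
        _ ≤ _ := by
            gcongr
            exact hpars.trans (by gcongr)
    have hLc : (L : ℝ) = 2 * m := by rw [hL]; push_cast; ring
    rw [hLc] at hfin
    have h6 : (m * y) ^ 2 ≤ (3 * K * M ^ 2 * ‖x‖) ^ 2 := by
      have h7 : m * (m * y) ^ 2 ≤ m * (6 * (K * M ^ 2 * ‖x‖) ^ 2) := by
        calc m * (m * y) ^ 2 = 3 * ((m : ℝ) ^ 3 / 3 * y ^ 2) := by ring
          _ ≤ 3 * (M ^ 2 * (K ^ 2 * (2 * m * (M * ‖x‖) ^ 2))) := by gcongr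
          _ = _ := by ring
      have h8 := le_of_mul_le_mul_left h7 hmR
      nlinarith [sq_nonneg (K * M ^ 2 * ‖x‖)]
    have h9 : m * y ≤ 3 * K * M ^ 2 * ‖x‖ :=
      (sq_le_sq₀ (by positivity) (by positivity)).1 h6
    rw [div_mul_eq_mul_div, le_div_iff₀ hmR]
    linarith
  refine (ContinuousLinearMap.opNorm_le_bound _ (by positivity) main).trans ?_
  gcongr
  linarith
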